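/- arXiv:2301.05613 — 2 statements merged into one kernel-verified Lean document; each statement's English description precedes it below -/
import Mathlib

section
/- Let K₁ and K₂ be fields of characteristic 2. If the stable linear groups GL(K₁) and GL(K₂) are elementarily equivalent as structures in the first-order language of groups, then the groups GL₂(K₁) and GL₂(K₂) are elementarily equivalent as structures in the first-order language of groups. -/
/-- The functions of the first-order language of groups:
multiplication (binary), inverse (unary) and identity (constant). -/
inductive groupFunc : ℕ → Type
  | mul : groupFunc 2
  | inv : groupFunc 1
  | one : groupFunc 0

/-- The first-order language of groups. -/
def groupLang : FirstOrder.Language :=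
  { Functions := groupFunc, Relations := fun _ => Empty }

/-- The canonical `groupLang`-structure on a group. -/
def groupStructure (G : Type*) [Group G] : groupLang.Structure G where
  funMap {n} f x :=
    match f with
    | .mul => x 0 * x 1
    | .inv => (x 0)⁻¹
    | .one => 1
  RelMap {n} r _ := r.elim

/-- The stable linear group `GL(K)`: the group of `ℕ × ℕ` matrices over `K` that
differ from the identity in only finitely many entries and are invertible;
realized as the group of `K`-linear automorphisms of `ℕ →₀ K` fixing all but
finitely many of the standard basis vectors. -/
def StableGL (K : Type*) [Field K] : Subgroup ((ℕ →₀ K) ≃ₗ[K] (ℕ →₀ K)) where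
  carrier := {f | {j : ℕ | f (Finsupp.single j 1) ≠ Finsupp.single j 1}.Finite}
  one_mem' := by
    show Set.Finite _
    have h1 : {j : ℕ | (1 : (ℕ →₀ K) ≃ₗ[K] (ℕ →₀ K)) (Finsupp.single j 1) ≠
        Finsupp.single j 1} = ∅ := by
      ext j
      simp [LinearEquiv.coe_one]
    rw [h1]
    exact Set.finite_empty
  mul_mem' := by
    intro a b ha hb
    refine Set.Finite.subset (ha.union hb) ?_
    intro j hj
    by_contra h
    simp only [Set.mem_union, Set.mem_setOf_eq, not_or, not_not] at h
    exact hj (by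
      show a (b (Finsupp.single j 1)) = Finsupp.single j 1
      rw [h.2, h.1])
  inv_mem' := by
    intro a ha
    refine Set.Finite.subset ha ?_
    intro j hj
    by_contra h
    simp only [Set.mem_setOf_eq, not_not] at h
    refine hj ?_
    have h2 : a⁻¹ (a (Finsupp.single j 1)) = Finsupp.single j 1 :=
      a.symm_apply_apply _
    rwa [h] at h2

section BicommutantFormulas

open FirstOrder FirstOrder.Language

attribute [local instance] groupStructure

/-- The element `x` commutes with everything that commutes with both `a` and `b`. -/
def InBicommutant {G : Type*} [Group G] (a b x : G) : Prop :=
  ∀ y : G, y * a = a * y → y * b = b * y → x * y = y * x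

/-- The pair `(a, b)` generates a copy of the symmetric group on three letters, and the centre of
its centralizer contains no involution. -/
def IsCleanBraidPair {G : Type*} [Group G] (a b : G) : Prop :=
  a * a = 1 ∧ b * b = 1 ∧ a * b * a = b * a * b ∧ a ≠ 1 ∧
    ∀ z : G, z * a = a * z → z * b = b * z → InBicommutant a b z → z * z = 1 → z = 1

namespace groupLang

/-- The product of two terms of the language of groups. -/
def termMul {α : Type*} (s t : groupLang.Term α) : groupLang.Term α :=
  Functions.apply₂ (L := groupLang) groupFunc.mul s t

/-- The term denoting the identity element. -/
def termOne {α : Type*} : groupLang.Term α :=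
  Constants.term (L := groupLang) groupFunc.one

theorem realize_termMul {α G : Type*} [Group G] (s t : groupLang.Term α) (v : α → G) :
    (termMul s t).realize v = s.realize v * t.realize v := by
  exact Term.realize_functions_apply₂ (L := groupLang) (f := groupFunc.mul)

theorem realize_termOne {α G : Type*} [Group G] (v : α → G) :
    (termOne : groupLang.Term α).realize v = 1 := by
  exact Term.realize_constants (L := groupLang) (c := groupFunc.one)

/-- The formula saying that two terms commute. -/
def commuteFormula {α : Type*} {n : ℕ} (s t : groupLang.Term (α ⊕ Fin n)) :
    groupLang.BoundedFormula α n :=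
  (termMul s t).bdEqual (termMul t s)

/-- The formula saying that the last bound variable lies in the bicommutant of the two
parameters. -/
def bicommutantFormula (n : ℕ) : groupLang.BoundedFormula (Fin 2) (n + 1) :=
  let x : groupLang.Term (Fin 2 ⊕ Fin (n + 2)) := .var (.inr (Fin.last n).castSucc)
  let y : groupLang.Term (Fin 2 ⊕ Fin (n + 2)) := .var (.inr (Fin.last (n + 1)))
  ((commuteFormula y (.var (.inl 0))).imp
    ((commuteFormula y (.var (.inl 1))).imp (commuteFormula x y))).all

/-- The formula saying that the two parameters satisfy `IsCleanBraidPair`. -/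
def cleanBraidPairFormula : groupLang.Formula (Fin 2) :=
  let a : groupLang.Term (Fin 2 ⊕ Fin 0) := .var (.inl 0)
  let b : groupLang.Term (Fin 2 ⊕ Fin 0) := .var (.inl 1)
  let z : groupLang.Term (Fin 2 ⊕ Fin 1) := .var (.inr 0)
  (termMul a a).bdEqual termOne ⊓ ((termMul b b).bdEqual termOne ⊓
    ((termMul (termMul a b) a).bdEqual (termMul (termMul b a) b) ⊓
      ((a.bdEqual termOne).not ⊓
        ((commuteFormula z (.var (.inl 0))).imp ((commuteFormula z (.var (.inl 1))).imp
          ((bicommutantFormula 0).imp (((termMul z z).bdEqual termOne).imp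
            (z.bdEqual termOne))))).all)))

/-- Relativization of a formula to the bicommutant of the two parameters. -/
def relativize : ∀ {n : ℕ}, groupLang.BoundedFormula Empty n → groupLang.BoundedFormula (Fin 2) n
  | _, .falsum => .falsum
  | _, .equal s t => .equal (s.relabel (Sum.map Empty.elim id)) (t.relabel (Sum.map Empty.elim id))
  | _, .rel r _ => r.elim
  | _, .imp f g => .imp (relativize f) (relativize g)
  | n, .all f => .all (.imp (bicommutantFormula n) (relativize f))

variable {G H : Type*} [Group G] [Group H]

theorem realize_commuteFormula {α : Type*} {n : ℕ} (s t : groupLang.Term (α ⊕ Fin n))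
    (v : α → G) (xs : Fin n → G) :
    (commuteFormula s t).Realize v xs ↔
      s.realize (Sum.elim v xs) * t.realize (Sum.elim v xs) =
        t.realize (Sum.elim v xs) * s.realize (Sum.elim v xs) := by
  rw [commuteFormula, BoundedFormula.realize_bdEqual, realize_termMul, realize_termMul]

theorem realize_bicommutantFormula (n : ℕ) (v : Fin 2 → G) (xs : Fin (n + 1) → G) :
    (bicommutantFormula n).Realize v xs ↔ InBicommutant (v 0) (v 1) (xs (Fin.last n)) := by
  simp only [bicommutantFormula, BoundedFormula.realize_all, BoundedFormula.realize_imp,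
    realize_commuteFormula, Term.realize_var, Sum.elim_inl, Sum.elim_inr, Fin.snoc_castSucc,
    Fin.snoc_last, InBicommutant]

theorem realize_cleanBraidPairFormula (v : Fin 2 → G) :
    cleanBraidPairFormula.Realize v ↔ IsCleanBraidPair (v 0) (v 1) := by
  have key (z : G) : (Fin.snoc (default : Fin 0 → G) z : Fin 1 → G) 0 = z :=
    Fin.snoc_last (α := fun _ => G) z default
  simp only [cleanBraidPairFormula, Formula.Realize, BoundedFormula.realize_all,
    BoundedFormula.realize_imp, BoundedFormula.realize_inf, BoundedFormula.realize_not,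
    BoundedFormula.realize_bdEqual, realize_commuteFormula, realize_bicommutantFormula,
    realize_termMul, realize_termOne, Term.realize_var, Sum.elim_inl, Sum.elim_inr,
    IsCleanBraidPair, key, ne_eq, Fin.snoc_last]

theorem map_realize {α : Type*} (φ : H →* G) (t : groupLang.Term α) (v : α → H) :
    t.realize (φ ∘ v) = φ (t.realize v) := by
  induction t with
  | var => rfl
  | func f ts ih =>
    simp only [Term.realize, ih]
    cases f with
    | mul => exact (φ.map_mul _ _).symm
    | inv => exact (φ.map_inv _).symm
    | one => exact φ.map_one.symm

theorem realize_relativize (φ : H →* G) (hφ : Function.Injective φ) (v : Fin 2 → G)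
    (hv : ∀ g, InBicommutant (v 0) (v 1) g ↔ g ∈ Set.range φ) {n : ℕ}
    (f : groupLang.BoundedFormula Empty n) (xs : Fin n → H) :
    (relativize f).Realize v (φ ∘ xs) ↔ f.Realize default xs := by
  induction f with
  | falsum => rfl
  | equal s t =>
    have key : Sum.elim v (φ ∘ xs) ∘ Sum.map Empty.elim id =
        φ ∘ Sum.elim (default : Empty → H) xs := by
      funext i
      rcases i with i | i
      · exact i.elim
      · rfl
    simp only [relativize, BoundedFormula.Realize, Term.realize_relabel, key, map_realize,
      hφ.eq_iff]
  | rel r _ => exact r.elim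
  | imp f g ihf ihg => simp only [relativize, BoundedFormula.realize_imp, ihf, ihg]
  | @all m f ih =>
    simp only [relativize, BoundedFormula.realize_all, BoundedFormula.realize_imp,
      realize_bicommutantFormula, Fin.snoc_last, hv, Set.forall_mem_range]
    refine forall_congr' fun x => ?_
    rw [← ih, Fin.comp_snoc]

/-- If a clean braid pair exists in `G` and all their bicommutants are isomorphic to `H`, then
every sentence about `H` translates to one about `G`. -/
theorem realize_iExs_relativize_iff (hex : ∃ a b : G, IsCleanBraidPair a b)
    (hiso : ∀ a b : G, IsCleanBraidPair a b →
      ∃ φ : H →* G, Function.Injective φ ∧ ∀ g, InBicommutant a b g ↔ g ∈ Set.range φ)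
    (f : groupLang.Sentence) :
    G ⊨ (((cleanBraidPairFormula ⊓ relativize f).relabel Sum.inr :
      groupLang.Formula (Empty ⊕ Fin 2)).iExs (Fin 2)) ↔ H ⊨ f := by
  have key (v : Fin 2 → G) (h : IsCleanBraidPair (v 0) (v 1)) :
      (relativize f).Realize v default ↔ H ⊨ f := by
    obtain ⟨φ, hφ, hran⟩ := hiso _ _ h
    rw [Sentence.Realize, Formula.Realize, ← realize_relativize φ hφ v hran f default]
    exact iff_of_eq (congrArg _ (Subsingleton.elim _ _))
  rw [Sentence.Realize, Formula.realize_iExs]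
  simp only [Formula.realize_relabel, Sum.elim_comp_inr, Formula.realize_inf,
    realize_cleanBraidPairFormula]
  constructor
  · rintro ⟨v, hv, h⟩
    exact (key v hv).1 h
  · intro h
    obtain ⟨a, b, hab⟩ := hex
    exact ⟨![a, b], hab, (key ![a, b] hab).2 h⟩

end groupLang

end BicommutantFormulas


section MatrixUnits

variable {K R : Type*} [Field K] [Ring R] [Algebra K R]

/-- The elements `p` and `q` behave like the off-diagonal matrix units of the algebra of
`2 × 2` matrices. -/
structure IsOffDiagonalPair (p q : R) : Prop where
  left_sq : p * p = 0
  right_sq : q * q = 0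
  left_right_left : p * (q * p) = p
  right_left_right : q * (p * q) = q

namespace IsOffDiagonalPair

variable {p q : R} (h : IsOffDiagonalPair p q)
include h

theorem left_sq_assoc (x : R) : p * (p * x) = 0 := by
  rw [← mul_assoc, h.left_sq, zero_mul]

theorem right_sq_assoc (x : R) : q * (q * x) = 0 := by
  rw [← mul_assoc, h.right_sq, zero_mul]

theorem left_mul_right_ne_zero (hp : p ≠ 0) : p * q ≠ 0 := by
  intro h0
  apply hp
  rw [← h.left_right_left, ← mul_assoc, h0, zero_mul]

/-- The multiplicative map sending a `2 × 2` matrix to the corresponding combination of the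
matrix units built from `p` and `q`, extended by the complementary idempotent. -/
def ofMatrix : Matrix (Fin 2) (Fin 2) K →* R where
  toFun A := 1 - p * q - q * p +
    (A 0 0 • (p * q) + A 0 1 • p + A 1 0 • q + A 1 1 • (q * p))
  map_one' := by simp
  map_mul' A B := by
    simp only [Matrix.mul_apply, Fin.sum_univ_two, mul_add, add_mul, mul_sub, sub_mul, mul_one,
      one_mul, smul_mul_assoc, mul_smul_comm, mul_assoc, h.left_sq, h.right_sq,
      h.left_right_left, h.right_left_right, h.left_sq_assoc, h.right_sq_assoc, smul_zero, mul_zero]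
    module

theorem ofMatrix_apply (A : Matrix (Fin 2) (Fin 2) K) :
    h.ofMatrix A = 1 - p * q - q * p +
      (A 0 0 • (p * q) + A 0 1 • p + A 1 0 • q + A 1 1 • (q * p)) := rfl

theorem ofMatrix_sub_one (A : Matrix (Fin 2) (Fin 2) K) :
    h.ofMatrix A - 1 = (-1 : K) • (p * q + q * p) +
      (A 0 0 • (p * q) + A 0 1 • p + A 1 0 • q + A 1 1 • (q * p)) := by
  rw [ofMatrix_apply]
  module

theorem commute_ofMatrix {x : R} (hxp : x * p = p * x) (hxq : x * q = q * x)
    (A : Matrix (Fin 2) (Fin 2) K) : Commute (h.ofMatrix A) x := by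
  have hp : Commute p x := hxp.symm
  have hq : Commute q x := hxq.symm
  rw [ofMatrix_apply]
  exact (((Commute.one_left x).sub_left (hp.mul_left hq)).sub_left (hq.mul_left hp)).add_left
    (((((hp.mul_left hq).smul_left _).add_left (hp.smul_left _)).add_left
      (hq.smul_left _)).add_left ((hq.mul_left hp).smul_left _))

theorem corners_ofMatrix (A : Matrix (Fin 2) (Fin 2) K) :
    p * q * h.ofMatrix A * (p * q) = A 0 0 • (p * q) ∧
    p * q * h.ofMatrix A * q = A 0 1 • (p * q) ∧
    p * h.ofMatrix A * (p * q) = A 1 0 • (p * q) ∧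
    p * h.ofMatrix A * q = A 1 1 • (p * q) := by
  refine ⟨?_, ?_, ?_, ?_⟩ <;>
  simp only [ofMatrix_apply, mul_add, add_mul, mul_sub, sub_mul, mul_one,
      smul_mul_assoc, mul_smul_comm, mul_assoc, h.left_sq, h.right_sq,
      h.left_right_left, h.right_left_right, h.left_sq_assoc, h.right_sq_assoc, smul_zero,
      mul_zero, zero_mul] <;>
  module

theorem ofMatrix_injective (hp : p ≠ 0) :
    Function.Injective (h.ofMatrix : Matrix (Fin 2) (Fin 2) K →* R) := by
  intro A B hAB
  obtain ⟨a₁, a₂, a₃, a₄⟩ := h.corners_ofMatrix A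
  obtain ⟨b₁, b₂, b₃, b₄⟩ := h.corners_ofMatrix B
  rw [hAB] at a₁ a₂ a₃ a₄
  have inj := smul_left_injective K (h.left_mul_right_ne_zero hp)
  ext i j
  fin_cases i <;> fin_cases j
  · exact inj (a₁.symm.trans b₁)
  · exact inj (a₂.symm.trans b₂)
  · exact inj (a₃.symm.trans b₃)
  · exact inj (a₄.symm.trans b₄)

/-- An element acting trivially outside the matrix-unit block, all of whose block entries are
scalar, comes from a matrix. -/
theorem eq_ofMatrix {x : R} (hl : (1 - p * q - q * p) * x = 1 - p * q - q * p)
    (hr : x * (1 - p * q - q * p) = 1 - p * q - q * p) {α β γ δ : K}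
    (h₁ : p * q * x * (p * q) = α • (p * q)) (h₂ : p * q * x * q = β • (p * q))
    (h₃ : p * x * (p * q) = γ • (p * q)) (h₄ : p * x * q = δ • (p * q)) :
    x = h.ofMatrix !![α, β; γ, δ] := by
  have e₂ : p * q * x * (q * p) = β • p := by
    rw [← mul_assoc, h₂, smul_mul_assoc, mul_assoc, h.left_right_left]
  have e₃ : q * p * x * (p * q) = γ • q := by
    rw [mul_assoc q, mul_assoc q, h₃, mul_smul_comm, h.right_left_right]
  have e₄ : q * p * x * (q * p) = δ • (q * p) := by
    rw [← mul_assoc, mul_assoc q, mul_assoc q, h₄, mul_smul_comm, h.right_left_right,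
      smul_mul_assoc]
  rw [ofMatrix_apply]
  simp only [Matrix.of_apply, Matrix.cons_val', Matrix.cons_val_zero, Matrix.cons_val_one,
    Matrix.cons_val_fin_one]
  rw [← h₁, ← e₂, ← e₃, ← e₄]
  have hE : (1 - p * q - q * p) * (1 - p * q - q * p) = 1 - p * q - q * p := by
    simp only [mul_sub, sub_mul, mul_one, one_mul, mul_assoc,
      h.right_left_right, h.left_right_left, h.left_sq_assoc, h.right_sq_assoc, mul_zero]
    abel
  have hc (f : R) (h₁ : f * x = f) (h₂ : x * f = f) (h₃ : f * f = f) :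
      (1 - f) * (x * (1 - f)) = x - f := by
    rw [mul_sub x, mul_one, h₂, mul_sub, sub_mul, sub_mul, one_mul, one_mul, h₁, h₃, sub_self,
      sub_zero]
  rw [← sub_eq_iff_eq_add', ← hc _ hl hr hE]
  simp only [mul_sub, sub_mul, mul_one, one_mul, mul_assoc]
  abel

/-- In characteristic two, an involution commuting with both off-diagonal units and acting
trivially outside the block is trivial. -/
theorem ofMatrix_eq_one [CharP K 2] (hp : p ≠ 0) {A : Matrix (Fin 2) (Fin 2) K}
    (hl : h.ofMatrix A * p = p * h.ofMatrix A) (hr : h.ofMatrix A * q = q * h.ofMatrix A)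
    (hsq : h.ofMatrix A * h.ofMatrix A = 1) : h.ofMatrix A = 1 := by
  obtain ⟨a₁, a₂, a₃, a₄⟩ := h.corners_ofMatrix A
  have inj := smul_left_injective K (h.left_mul_right_ne_zero hp)
  have h₁₀ : A 1 0 = 0 := by
    apply inj
    simp only [zero_smul]
    rw [← a₃, ← hl, mul_assoc, h.left_sq_assoc, mul_zero]
  have h₀₁ : A 0 1 = 0 := by
    apply inj
    simp only [zero_smul]
    rw [← a₂, mul_assoc, hr, mul_assoc, h.right_sq_assoc, mul_zero]
  have h₁₁ : A 0 0 = A 1 1 := by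
    apply inj
    simp only
    rw [← a₁, ← a₄, ← hl]
    rw [mul_assoc p q, ← hr, mul_assoc p, mul_assoc _ q, h.right_left_right, mul_assoc, hr,
      ← mul_assoc, ← mul_assoc, hl, mul_assoc, ← hr, mul_assoc]
  have hA : A * A = 1 := h.ofMatrix_injective hp (by rw [map_mul, hsq, map_one])
  have hs : A 0 0 * A 0 0 = 1 := by
    have := congrFun (congrFun hA 0) 0
    simpa [Matrix.mul_apply, Fin.sum_univ_two, h₀₁] using this
  have hone : A 0 0 = 1 := by
    have hz : (A 0 0 - 1) * (A 0 0 - 1) = 0 := by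
      linear_combination hs + (1 - A 0 0) * CharTwo.two_eq_zero (R := K)
    exact sub_eq_zero.1 (mul_self_eq_zero.1 hz)
  have hA1 : A = 1 := by
    ext i j
    fin_cases i <;> fin_cases j <;> simp [hone, h₁₀, h₀₁, ← h₁₁]
  rw [hA1, map_one]

end IsOffDiagonalPair

section Braid

variable {a b : R}

/-- The sum over the group generated by two involutions satisfying the braid relation. -/
def braidSum (a b : R) : R := 1 + a + b + a * b + b * a + a * b * a

theorem braidSum_apply (a b : R) : braidSum a b = 1 + a + b + a * b + b * a + a * b * a := rfl

theorem left_mul_braidSum (ha : a * a = 1) :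
    a * braidSum a b = braidSum a b := by
  have h₁ : a * (a * b) = b := by rw [← mul_assoc, ha, one_mul]
  have h₂ : a * (a * b * a) = b * a := by rw [← mul_assoc, h₁]
  simp only [braidSum, mul_add, ha, h₁, h₂, mul_one, ← mul_assoc a b a]
  abel

theorem right_mul_braidSum (hb : b * b = 1) (hab : a * b * a = b * a * b) :
    b * braidSum a b = braidSum a b := by
  have h₁ : b * (b * a) = a := by rw [← mul_assoc, hb, one_mul]
  have h₂ : b * (a * b * a) = a * b := by
    rw [hab, mul_assoc, ← mul_assoc b b, hb, one_mul]
  have h₃ : b * (a * b) = a * b * a := by rw [hab, mul_assoc]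
  simp only [braidSum, mul_add, hb, h₁, h₂, h₃, mul_one]
  abel

theorem braidSum_mul_left (ha : a * a = 1) :
    braidSum a b * a = braidSum a b := by
  have h₁ : b * a * a = b := by rw [mul_assoc, ha, mul_one]
  have h₂ : a * b * a * a = a * b := by rw [mul_assoc, ha, mul_one]
  simp only [braidSum, add_mul, ha, h₁, h₂, one_mul]
  abel

theorem braidSum_mul_right (hb : b * b = 1) (hab : a * b * a = b * a * b) :
    braidSum a b * b = braidSum a b := by
  have h₁ : a * b * b = a := by rw [mul_assoc, hb, mul_one]
  have h₂ : a * b * a * b = b * a := by rw [hab, mul_assoc, hb, mul_one]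
  simp only [braidSum, add_mul, hb, h₁, h₂, hab.symm, one_mul]
  abel

theorem braidSum_mul_self (h2 : ∀ x : R, x + x = 0) (ha : a * a = 1) (hb : b * b = 1)
    (hab : a * b * a = b * a * b) : braidSum a b * braidSum a b = 0 := by
  have hl := left_mul_braidSum (b := b) ha
  have hr := right_mul_braidSum hb hab
  nth_rewrite 1 [braidSum_apply]
  simp only [add_mul, one_mul, mul_assoc, hl, hr, h2, zero_add]

theorem isOffDiagonalPair_of_braidSum_eq_zero (h2 : ∀ x : R, x + x = 0) (ha : a * a = 1)
    (hb : b * b = 1) (hab : a * b * a = b * a * b) (h0 : braidSum a b = 0) :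
    IsOffDiagonalPair (a + 1) (b + 1) where
  left_sq := by
    simp only [mul_add, add_mul, ha, mul_one, one_mul]
    rw [add_comm 1 a, h2]
  right_sq := by
    simp only [mul_add, add_mul, hb, mul_one, one_mul]
    rw [add_comm 1 b, h2]
  left_right_left := by
    have h : (a + 1) * ((b + 1) * (a + 1)) = braidSum a b + (a + 1) := by
      simp only [braidSum, mul_add, add_mul, ha, mul_one, one_mul, ← mul_assoc]
      abel
    rw [h, h0, zero_add]
  right_left_right := by
    have h : (b + 1) * ((a + 1) * (b + 1)) = braidSum a b + (b + 1) := by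
      simp only [braidSum, mul_add, add_mul, hb, mul_one, one_mul, ← mul_assoc, hab]
      abel
    rw [h, h0, zero_add]

end Braid

end MatrixUnits


section Finitary

open Module

variable {K V : Type*} [Field K] [AddCommGroup V] [Module K V] {B : Basis ℕ K V}

/-- An endomorphism is finitary with respect to a basis if it kills almost all basis vectors. -/
def IsFinitary (B : Basis ℕ K V) (T : End K V) : Prop :=
  {j : ℕ | T (B j) ≠ 0}.Finite

namespace IsFinitary

variable {S T : End K V}

theorem mul_left (hT : IsFinitary B T) (S : End K V) : IsFinitary B (S * T) := by
  refine Set.Finite.subset hT fun j hj h0 => hj ?_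
  rw [End.mul_apply, h0, map_zero]

theorem add (hS : IsFinitary B S) (hT : IsFinitary B T) : IsFinitary B (S + T) := by
  refine Set.Finite.subset (Set.Finite.union hS hT) fun j hj => ?_
  by_contra h
  simp only [Set.mem_union, Set.mem_ofPred_eq, not_or, not_not] at h
  exact hj (by rw [LinearMap.add_apply, h.1, h.2, add_zero])

theorem smul (hT : IsFinitary B T) (c : K) : IsFinitary B (c • T) := by
  refine Set.Finite.subset hT fun j hj h0 => hj ?_
  rw [LinearMap.smul_apply, h0, smul_zero]

end IsFinitary

section Block

variable {p q x : End K V}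

/-- The endomorphism `x` commutes with every finitary square-zero endomorphism that commutes with
`p` and `q`. -/
def CommutesWithTransvections (B : Basis ℕ K V) (p q x : End K V) : Prop :=
  ∀ T : End K V, IsFinitary B T → T * T = 0 → T * p = p * T → T * q = q * T → x * T = T * x

/-- The rank-one endomorphism with image spanned by `v` and coefficient function the `j`-th
coordinate outside the block of `p` and `q`. -/
noncomputable def outerTransvection (B : Basis ℕ K V) (p q : End K V) (j : ℕ) (v : V) : End K V :=
  ((B.coord j).comp (1 - p * q - q * p)).smulRight v

theorem outerTransvection_apply (j : ℕ) (v u : V) :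
    outerTransvection B p q j v u = B.coord j ((1 - p * q - q * p) u) • v := rfl

section

variable (h : IsOffDiagonalPair p q)
include h

/-- If `x` commutes with all transvections then it acts trivially outside the block. -/
theorem CommutesWithTransvections.outer_trivial (hp : IsFinitary B p) (hq : IsFinitary B q)
    (hx : IsFinitary B (x - 1)) (hcomm : CommutesWithTransvections B p q x) :
    (1 - p * q - q * p) * x = 1 - p * q - q * p ∧
      x * (1 - p * q - q * p) = 1 - p * q - q * p := by
  have hT (j : ℕ) (v u : V) := outerTransvection_apply (B := B) (p := p) (q := q) j v u
  have hfone (u : V) : (1 - p * q - q * p) u = u - (p * q + q * p) u := by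
    rw [sub_sub]
    rfl
  have hfp : (1 - p * q - q * p) * p = 0 := by
    rw [sub_mul, sub_mul, one_mul, mul_assoc, mul_assoc, h.left_right_left, h.left_sq, mul_zero,
      sub_zero, sub_self]
  have hfq : (1 - p * q - q * p) * q = 0 := by
    rw [sub_mul, sub_mul, one_mul, mul_assoc, mul_assoc, h.right_left_right, h.right_sq, mul_zero,
      sub_zero, sub_self]
  have hpf : p * (1 - p * q - q * p) = 0 := by
    rw [mul_sub, mul_sub, mul_one, h.left_sq_assoc, h.left_right_left, sub_zero, sub_self]
  have hqf : q * (1 - p * q - q * p) = 0 := by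
    rw [mul_sub, mul_sub, mul_one, h.right_left_right, h.right_sq_assoc, sub_zero, sub_self]
  have hfin : IsFinitary B (p * q + q * p) := (hq.mul_left p).add (hp.mul_left q)
  generalize 1 - p * q - q * p = f at *
  have hfix {v : V} (hpv : p v = 0) (hqv : q v = 0) : f v = v := by
    simp [hfone, hpv, hqv]
  have main (j : ℕ) (v : V) (hpv : p v = 0) (hqv : q v = 0) (hvj : B.coord j v = 0) :
      x * outerTransvection B p q j v = outerTransvection B p q j v * x := by
    refine hcomm _ ?_ ?_ ?_ ?_
    · refine Set.Finite.subset (Set.Finite.union hfin (Set.finite_singleton j)) fun i hi => ?_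
      by_contra hc
      simp only [Set.mem_union, Set.mem_ofPred_eq, Set.mem_singleton_iff, not_or, not_not] at hc
      apply hi
      rw [hT, hfone, hc.1, sub_zero, B.coord_apply, B.repr_self, Finsupp.single_eq_of_ne' hc.2,
        zero_smul]
    · refine LinearMap.ext fun u => ?_
      simp only [End.mul_apply, hT, map_smul, hfix hpv hqv, hvj, smul_zero, zero_smul,
        LinearMap.zero_apply]
    · refine LinearMap.ext fun u => ?_
      rw [End.mul_apply, End.mul_apply, hT, hT, map_smul, hpv, ← End.mul_apply f, hfp]
      simp
    · refine LinearMap.ext fun u => ?_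
      rw [End.mul_apply, End.mul_apply, hT, hT, map_smul, hqv, ← End.mul_apply f, hfq]
      simp
  have hxv (v : V) (hpv : p v = 0) (hqv : q v = 0) : x v = v := by
    obtain ⟨j, hj⟩ := (Set.Finite.union (Set.Finite.union hx hfin)
      (B.repr v).support.finite_toSet).exists_notMem
    simp only [Set.mem_union, Set.mem_ofPred_eq, not_or, not_not, Finset.mem_coe,
      Finsupp.notMem_support_iff] at hj
    obtain ⟨⟨hj₁, hj₂⟩, hvj⟩ := hj
    have hxj : x (B j) = B j := sub_eq_zero.1 hj₁
    have := LinearMap.congr_fun (main j v hpv hqv hvj) (B j)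
    rw [End.mul_apply, End.mul_apply, hxj, hT, hfone, hj₂] at this
    simpa using this
  constructor
  · refine LinearMap.ext fun u => B.ext_elem fun j => ?_
    obtain ⟨i, hi⟩ := (Set.Finite.union (Set.Finite.union hp hq)
      (Set.finite_singleton j)).exists_notMem
    simp only [Set.mem_union, Set.mem_ofPred_eq, Set.mem_singleton_iff, not_or, not_not] at hi
    obtain ⟨⟨hpi, hqi⟩, hij⟩ := hi
    have := LinearMap.congr_fun (main j (B i) hpi hqi (by
      rw [B.coord_apply, B.repr_self, Finsupp.single_eq_of_ne' hij])) u
    rw [End.mul_apply, End.mul_apply, hT, hT, map_smul, hxv _ hpi hqi] at this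
    exact (smul_left_injective K (B.ne_zero i) this).symm
  · refine LinearMap.ext fun u => ?_
    refine hxv _ ?_ ?_
    · rw [← End.mul_apply, hpf, LinearMap.zero_apply]
    · rw [← End.mul_apply, hqf, LinearMap.zero_apply]

/-- The square-zero endomorphism acting as `w ⊗ f` on each of the two isomorphic halves of the
block. -/
theorem exists_inner_transvection (hp : IsFinitary B p) (hq : IsFinitary B q) {w : V}
    (hw : (p * q) w = w) (f : Dual K V) (hf : f w = 0) :
    ∃ T : End K V, IsFinitary B T ∧ T * T = 0 ∧ T * p = p * T ∧ T * q = q * T ∧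
      ∀ u, (p * q) u = u → T u = f u • w := by
  set R : End K V := f.smulRight w with hR
  have hRR : p * (q * R) = R := by
    refine LinearMap.ext fun u => ?_
    rw [← mul_assoc, End.mul_apply, hR, LinearMap.smulRight_apply, map_smul, hw]
  have hR0 : R * R = 0 := by
    refine LinearMap.ext fun u => ?_
    simp [hR, hf]
  have hpR : p * R = 0 := by
    rw [← hRR, h.left_sq_assoc]
  have hmul (S : End K V) : R * (R * S) = 0 := by rw [← mul_assoc, hR0, zero_mul]
  have hpmul (S : End K V) : p * (R * S) = 0 := by rw [← mul_assoc, hpR, zero_mul]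
  have hpqmul (S : End K V) : p * (q * (R * S)) = R * S := by
    rw [← mul_assoc q, ← mul_assoc p, hRR]
  refine ⟨R * p * q + q * R * p, (hq.mul_left _).add (hp.mul_left _), ?_, ?_, ?_, ?_⟩
  · simp only [mul_add, add_mul, mul_assoc, h.right_sq_assoc, hmul, hpmul, hpqmul, mul_zero,
      add_zero]
  · simp only [mul_add, add_mul, mul_assoc, h.left_sq, h.left_right_left, hpmul, hpqmul, mul_zero,
      add_zero, zero_add]
  · simp only [mul_add, add_mul, mul_assoc, h.right_sq, h.right_sq_assoc, mul_zero, add_zero,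
      zero_add]
  · intro u hu
    have hpu : p u = 0 := by
      rw [← hu, ← End.mul_apply, h.left_sq_assoc, LinearMap.zero_apply]
    rw [mul_assoc, LinearMap.add_apply, End.mul_apply R, hu, End.mul_apply (q * R), hpu]
    simp [hR]

/-- An endomorphism of the first half of the block commuting with all inner transvections is
scalar. -/
theorem exists_corner_eq_smul (hp : IsFinitary B p) (hq : IsFinitary B q) {y : End K V}
    (hl : p * q * y = y) (hr : y * (p * q) = y)
    (hcomm : CommutesWithTransvections B p q y) :
    ∃ c : K, y = c • (p * q) := by
  have hyW (u : V) : (p * q) (y u) = y u := LinearMap.congr_fun hl u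
  have hspan (w : V) (hw : (p * q) w = w) : y w ∈ Submodule.span K {w} := by
    by_contra hn
    obtain ⟨f, hf, hf'⟩ := Submodule.exists_dual_map_eq_bot_of_notMem hn inferInstance
    have hfw : f w = 0 := by
      have : f w ∈ (Submodule.span K {w}).map f :=
        Submodule.mem_map_of_mem (Submodule.mem_span_singleton_self w)
      rwa [hf', Submodule.mem_bot] at this
    obtain ⟨T, hT, hsq, hTp, hTq, hTu⟩ := exists_inner_transvection h hp hq hw f hfw
    have := LinearMap.congr_fun (hcomm T hT hsq hTp hTq) (y w)
    rw [End.mul_apply, End.mul_apply, hTu _ (hyW _), hTu _ (hyW _), map_smul] at this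
    apply hn
    rw [← inv_smul_smul₀ hf (y w), this]
    exact Submodule.smul_mem _ _ (Submodule.smul_mem _ _ (Submodule.mem_span_singleton_self w))
  let W : Submodule K (V) := LinearMap.range (p * q)
  have hidem : p * q * (p * q) = p * q := by rw [mul_assoc, h.right_left_right]
  have hW {u : V} (hu : u ∈ W) : (p * q) u = u := by
    obtain ⟨u, rfl⟩ := hu
    rw [← End.mul_apply, hidem]
  have hyW' : ∀ u ∈ W, y u ∈ W := fun u _ => ⟨y u, hyW u⟩
  obtain ⟨c, hc⟩ := LinearMap.exists_eq_smul_id_of_forall_notLinearIndependent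
    (f := y.restrict hyW') fun v hv => by
      obtain ⟨k, hk⟩ := Submodule.mem_span_singleton.1 (hspan v (hW v.2))
      have := LinearIndependent.pair_iff.1 hv k (-1) (by
        apply Subtype.ext
        simp [LinearMap.restrict_apply, hk])
      simpa using this.2
  refine ⟨c, LinearMap.ext fun u => ?_⟩
  have := congrArg Subtype.val (LinearMap.congr_fun hc ⟨(p * q) u, u, rfl⟩)
  simp only [LinearMap.restrict_apply, ← End.mul_apply, hr] at this
  exact this

/-- Double centralizer theorem for the block spanned by an off-diagonal pair. -/
theorem CommutesWithTransvections.exists_eq_ofMatrix (hp : IsFinitary B p) (hq : IsFinitary B q)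
    (hx : IsFinitary B (x - 1)) (hcomm : CommutesWithTransvections B p q x) :
    ∃ A : Matrix (Fin 2) (Fin 2) K, x = h.ofMatrix A := by
  obtain ⟨hl, hr⟩ := hcomm.outer_trivial h hp hq hx
  have key (s t : End K V) (hs : p * q * s = s) (ht : t * (p * q) = t)
      (hsT : ∀ T : End K V, T * p = p * T → T * q = q * T → Commute s T)
      (htT : ∀ T : End K V, T * p = p * T → T * q = q * T → Commute t T) :
      ∃ c : K, s * x * t = c • (p * q) := by
    refine exists_corner_eq_smul h hp hq ?_ ?_ ?_
    · rw [← mul_assoc, ← mul_assoc, hs]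
    · rw [mul_assoc, ht]
    · intro T hT hsq hTp hTq
      exact ((hsT T hTp hTq).mul_left (hcomm T hT hsq hTp hTq)).mul_left (htT T hTp hTq)
  have hpqT (T : End K V) (hTp : T * p = p * T) (hTq : T * q = q * T) :
      Commute (p * q) T := Commute.mul_left hTp.symm hTq.symm
  have hpT (T : End K V) (hTp : T * p = p * T) (_ : T * q = q * T) :
      Commute p T := hTp.symm
  have hqT (T : End K V) (_ : T * p = p * T) (hTq : T * q = q * T) :
      Commute q T := hTq.symm
  have hidem : p * q * (p * q) = p * q := by rw [mul_assoc, h.right_left_right]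
  have hpl : p * q * p = p := by rw [mul_assoc, h.left_right_left]
  obtain ⟨α, h₁⟩ := key (p * q) (p * q) hidem hidem hpqT hpqT
  obtain ⟨β, h₂⟩ := key (p * q) q hidem h.right_left_right hpqT hqT
  obtain ⟨γ, h₃⟩ := key p (p * q) hpl hidem hpT hpqT
  obtain ⟨δ, h₄⟩ := key p q hpl h.right_left_right hpT hqT
  exact ⟨_, h.eq_ofMatrix hl hr h₁ h₂ h₃ h₄⟩

end

end Block

end Finitary

section CharTwo

open Module

variable {K V G : Type*} [Field K] [AddCommGroup V] [Module K V] [Group G]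
  {B : Basis ℕ K V} {ι : G →* End K V}

theorem add_self_eq_zero_of_charP_two [CharP K 2] {M : Type*} [AddCommGroup M] [Module K M] (x : M) :
    x + x = 0 := by
  rw [← two_smul K x, CharTwo.two_eq_zero, zero_smul]

/-- The homomorphism `ι` identifies `G` with the group of all invertible endomorphisms differing
from the identity by a finitary one. -/
structure IsFinitaryRepresentation (B : Basis ℕ K V) (ι : G →* End K V) : Prop where
  injective : Function.Injective ι
  isFinitary_sub_one : ∀ g, IsFinitary B (ι g - 1)
  exists_eq : ∀ u : (End K V)ˣ, IsFinitary B ((u : End K V) - 1) → ∃ g, ι g = u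

namespace IsFinitaryRepresentation

variable (hι : IsFinitaryRepresentation B ι) {a b x : G}
include hι

theorem commute_iff {g h : G} : g * h = h * g ↔ ι g * ι h = ι h * ι g := by
  rw [← map_mul, ← map_mul, hι.injective.eq_iff]

theorem commute_iff_add_one : x * a = a * x ↔ ι x * (ι a + 1) = (ι a + 1) * ι x := by
  rw [hι.commute_iff, mul_add, add_mul, mul_one, one_mul, add_left_inj]

variable [CharP K 2]

theorem isFinitary_add_one (g : G) : IsFinitary B (ι g + 1) := by
  have h : ι g + 1 = ι g - 1 := by
    rw [eq_sub_iff_add_eq, add_assoc, add_self_eq_zero_of_charP_two (K := K) (1 : End K V),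
      add_zero]
  rw [h]
  exact hι.isFinitary_sub_one g

theorem exists_eq_one_add {T : End K V} (hT : IsFinitary B T) (hsq : T * T = 0) :
    ∃ g : G, ι g = 1 + T := by
  have h : (1 + T) * (1 + T) = 1 := by
    rw [mul_add, mul_one, add_mul, one_mul, hsq, add_zero, add_assoc,
      add_self_eq_zero_of_charP_two (K := K) T, add_zero]
  refine hι.exists_eq ⟨1 + T, 1 + T, h, h⟩ ?_
  rwa [add_sub_cancel_left]

theorem commutesWithTransvections (hx : InBicommutant a b x) :
    CommutesWithTransvections B (ι a + 1) (ι b + 1) (ι x) := by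
  intro T hT hsq hTa hTb
  obtain ⟨g, hg⟩ := hι.exists_eq_one_add hT hsq
  have := hx g
    (by rw [hι.commute_iff_add_one, hg, add_mul, mul_add (ι a + 1), hTa, one_mul, mul_one])
    (by rw [hι.commute_iff_add_one, hg, add_mul, mul_add (ι b + 1), hTb, one_mul, mul_one])
  rwa [hι.commute_iff, hg, mul_add, add_mul, mul_one, one_mul, add_right_inj] at this

theorem isFinitary_braidSum (a b : G) : IsFinitary B (braidSum (ι a) (ι b)) := by
  have h := (((((hι.isFinitary_add_one 1).add (hι.isFinitary_add_one a)).add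
    (hι.isFinitary_add_one b)).add (hι.isFinitary_add_one (a * b))).add
    (hι.isFinitary_add_one (b * a))).add (hι.isFinitary_add_one (a * b * a))
  have h6 : (6 : K) = 0 := by linear_combination 3 * CharTwo.two_eq_zero (R := K)
  have e : braidSum (ι a) (ι b) = ι 1 + 1 + (ι a + 1) + (ι b + 1) + (ι (a * b) + 1) +
      (ι (b * a) + 1) + (ι (a * b * a) + 1) := by
    rw [← add_zero (braidSum (ι a) (ι b)), ← zero_smul K (1 : End K V), ← h6]
    simp only [braidSum_apply, map_mul, map_one]
    module
  rwa [e]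

theorem braidSum_eq_zero (h : IsCleanBraidPair a b) : braidSum (ι a) (ι b) = 0 := by
  obtain ⟨haa, hbb, hab, -, hz⟩ := h
  have ha : ι a * ι a = 1 := by rw [← map_mul, haa, map_one]
  have hb : ι b * ι b = 1 := by rw [← map_mul, hbb, map_one]
  have hab' : ι a * ι b * ι a = ι b * ι a * ι b := by
    rw [← map_mul, ← map_mul, hab, map_mul, map_mul]
  have hsq := braidSum_mul_self (add_self_eq_zero_of_charP_two (K := K)) ha hb hab'
  obtain ⟨z, hzι⟩ := hι.exists_eq_one_add (hι.isFinitary_braidSum a b) hsq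
  have key : z = 1 := by
    apply hz z
    · rw [hι.commute_iff, hzι, add_mul, mul_add, one_mul, mul_one, left_mul_braidSum ha,
        braidSum_mul_left ha]
    · rw [hι.commute_iff, hzι, add_mul, mul_add, one_mul, mul_one, right_mul_braidSum hb hab',
        braidSum_mul_right hb hab']
    · intro y hya hyb
      rw [hι.commute_iff] at hya hyb ⊢
      have h₁ : Commute (ι y) (ι a) := hya
      have h₂ : Commute (ι y) (ι b) := hyb
      rw [hzι]
      exact ((Commute.one_right _).add_right ((((((Commute.one_right _).add_right h₁).add_right
        h₂).add_right (h₁.mul_right h₂)).add_right (h₂.mul_right h₁)).add_right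
        ((h₁.mul_right h₂).mul_right h₁))).symm
    · apply hι.injective
      rw [map_mul, hzι, map_one, mul_add, mul_one, add_mul, one_mul, hsq, add_zero, add_assoc,
        add_self_eq_zero_of_charP_two (K := K), add_zero]
  rw [key, map_one] at hzι
  exact add_eq_left.1 hzι.symm

theorem add_one_ne_zero (ha : a ≠ 1) : ι a + 1 ≠ 0 := by
  intro h0
  apply ha
  apply hι.injective
  rw [map_one, ← add_zero (ι a), ← add_self_eq_zero_of_charP_two (K := K) (1 : End K V),
    ← add_assoc, h0, zero_add]

theorem exists_eq_ofMatrix (h : IsOffDiagonalPair (ι a + 1) (ι b + 1)) (hx : InBicommutant a b x) :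
    ∃ A : Matrix (Fin 2) (Fin 2) K, ι x = h.ofMatrix A :=
  (hι.commutesWithTransvections hx).exists_eq_ofMatrix h (hι.isFinitary_add_one a)
    (hι.isFinitary_add_one b) (hι.isFinitary_sub_one x)

/-- The matrix group attached to an off-diagonal pair consists of elements of `G`. -/
theorem exists_monoidHom (h : IsOffDiagonalPair (ι a + 1) (ι b + 1)) :
    ∃ φ : GL (Fin 2) K →* G, ∀ A, ι (φ A) = h.ofMatrix A.val := by
  have hp := hι.isFinitary_add_one a
  have hq := hι.isFinitary_add_one b
  have hA (A : GL (Fin 2) K) : ∃ g, ι g = h.ofMatrix A.val := by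
    refine hι.exists_eq (Units.map h.ofMatrix A) ?_
    rw [Units.coe_map, h.ofMatrix_sub_one]
    exact (((hq.mul_left _).add (hp.mul_left _)).smul _).add
      (((((hq.mul_left _).smul _).add (hp.smul _)).add (hq.smul _)).add ((hp.mul_left _).smul _))
  choose φ hφ using hA
  refine ⟨MonoidHom.mk' φ fun A A' => hι.injective ?_, hφ⟩
  rw [map_mul, hφ, hφ, hφ, Units.val_mul, map_mul]

/-- The bicommutant of a clean braid pair is isomorphic to the general linear group of degree
two. -/
theorem exists_monoidHom_range_eq (hab : IsCleanBraidPair a b) :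
    ∃ φ : GL (Fin 2) K →* G, Function.Injective φ ∧
      ∀ g, InBicommutant a b g ↔ g ∈ Set.range φ := by
  have h : IsOffDiagonalPair (ι a + 1) (ι b + 1) :=
    isOffDiagonalPair_of_braidSum_eq_zero (add_self_eq_zero_of_charP_two (K := K))
      (by rw [← map_mul, hab.1, map_one]) (by rw [← map_mul, hab.2.1, map_one])
      (by rw [← map_mul, ← map_mul, hab.2.2.1, map_mul, map_mul]) (hι.braidSum_eq_zero hab)
  have hinj := h.ofMatrix_injective (K := K) (hι.add_one_ne_zero hab.2.2.2.1)
  obtain ⟨φ, hφ⟩ := hι.exists_monoidHom h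
  refine ⟨φ, fun A A' hAA' => Units.ext (hinj ?_), fun g => ⟨fun hg => ?_, ?_⟩⟩
  · rw [← hφ, ← hφ, hAA']
  · have hg' : InBicommutant a b g⁻¹ := fun y hya hyb => Commute.inv_left (hg y hya hyb)
    obtain ⟨A, hA⟩ := hι.exists_eq_ofMatrix h hg
    obtain ⟨A', hA'⟩ := hι.exists_eq_ofMatrix h hg'
    refine ⟨⟨A, A', hinj ?_, hinj ?_⟩, hι.injective ?_⟩
    · rw [map_mul, ← hA, ← hA', ← map_mul, mul_inv_cancel, map_one, map_one]
    · rw [map_mul, ← hA, ← hA', ← map_mul, inv_mul_cancel, map_one, map_one]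
    · exact (hφ _).trans hA.symm
  · rintro ⟨A, rfl⟩ y hya hyb
    rw [hι.commute_iff_add_one] at hya hyb
    rw [hι.commute_iff, hφ]
    exact h.commute_ofMatrix hya hyb A.val

/-- A braid pair of involutions whose braid sum vanishes is clean. -/
theorem isCleanBraidPair (haa : a * a = 1) (hbb : b * b = 1) (hab : a * b * a = b * a * b)
    (ha : a ≠ 1) (h0 : braidSum (ι a) (ι b) = 0) : IsCleanBraidPair a b := by
  refine ⟨haa, hbb, hab, ha, fun z hza hzb hz hzz => hι.injective ?_⟩
  have h : IsOffDiagonalPair (ι a + 1) (ι b + 1) :=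
    isOffDiagonalPair_of_braidSum_eq_zero (add_self_eq_zero_of_charP_two (K := K))
      (by rw [← map_mul, haa, map_one]) (by rw [← map_mul, hbb, map_one])
      (by rw [← map_mul, ← map_mul, hab, map_mul, map_mul]) h0
  rw [hι.commute_iff_add_one] at hza hzb
  obtain ⟨A, hA⟩ := hι.exists_eq_ofMatrix h hz
  have hzz' : ι z * ι z = 1 := by rw [← map_mul, hzz, map_one]
  rw [hA] at hza hzb hzz' ⊢
  rw [map_one]
  exact h.ofMatrix_eq_one (hι.add_one_ne_zero ha) hza hzb hzz'

end IsFinitaryRepresentation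

end CharTwo

namespace StableGL

open Module

variable {K : Type*} [Field K]

/-- The inclusion of the stable linear group into the endomorphism algebra. -/
noncomputable def toEnd : StableGL K →* End K (ℕ →₀ K) :=
  LinearEquiv.automorphismGroup.toLinearMapMonoidHom.comp (StableGL K).subtype

theorem isFinitaryRepresentation_toEnd [CharP K 2] :
    IsFinitaryRepresentation (Finsupp.basisSingleOne (R := K) (ι := ℕ)) (toEnd (K := K)) where
  injective g h hgh := Subtype.ext (LinearEquiv.toLinearMap_injective hgh)
  isFinitary_sub_one g := by
    refine Set.Finite.subset g.2 fun j hj h => hj ?_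
    rw [Finsupp.coe_basisSingleOne]
    exact sub_eq_zero.2 h
  exists_eq u hu := by
    refine ⟨⟨LinearMap.GeneralLinearGroup.generalLinearEquiv K _ u, ?_⟩, rfl⟩
    refine Set.Finite.subset hu fun j hj h => hj ?_
    rw [Finsupp.coe_basisSingleOne] at h
    exact sub_eq_zero.1 h

/-- The permutation matrix of a transposition. -/
noncomputable def swap (K : Type*) [Field K] (m n : ℕ) : StableGL K :=
  ⟨Finsupp.domLCongr (Equiv.swap m n), by
    refine Set.Finite.subset (Set.toFinite {m, n}) fun j hj => ?_
    by_contra hc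
    simp only [Set.mem_insert_iff, Set.mem_singleton_iff, not_or] at hc
    exact hj (by rw [Finsupp.domLCongr_single, Equiv.swap_apply_of_ne_of_ne hc.1 hc.2])⟩

theorem toEnd_swap_single (m n j : ℕ) :
    toEnd (swap K m n) (Finsupp.single j 1) = Finsupp.single (Equiv.swap m n j) 1 :=
  Finsupp.domLCongr_single _ _ _

theorem eq_of_toEnd_single {g h : StableGL K}
    (H : ∀ j, toEnd g (Finsupp.single j 1) = toEnd h (Finsupp.single j 1)) : g = h := by
  apply Subtype.ext
  apply LinearEquiv.toLinearMap_injective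
  refine Finsupp.basisSingleOne.ext fun j => ?_
  rw [Finsupp.coe_basisSingleOne]
  exact H j

theorem swap_mul_self (m n : ℕ) : swap K m n * swap K m n = 1 := by
  refine eq_of_toEnd_single fun j => ?_
  rw [map_mul, End.mul_apply, toEnd_swap_single, toEnd_swap_single, Equiv.swap_apply_self, map_one,
    End.one_apply]

theorem exists_isCleanBraidPair [CharP K 2] : ∃ a b : StableGL K, IsCleanBraidPair a b := by
  have hout (j : ℕ) (hj : 3 ≤ j) : Equiv.swap 0 1 j = j ∧ Equiv.swap 1 2 j = j :=
    ⟨Equiv.swap_apply_of_ne_of_ne (by omega) (by omega),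
      Equiv.swap_apply_of_ne_of_ne (by omega) (by omega)⟩
  have hcases (j : ℕ) : j = 0 ∨ j = 1 ∨ j = 2 ∨ 3 ≤ j := by omega
  have h₀ : Equiv.swap 1 2 0 = 0 := Equiv.swap_apply_of_ne_of_ne (by omega) (by omega)
  have h₂ : Equiv.swap 0 1 2 = 2 := Equiv.swap_apply_of_ne_of_ne (by omega) (by omega)
  refine ⟨swap K 0 1, swap K 1 2, isFinitaryRepresentation_toEnd.isCleanBraidPair
    (swap_mul_self _ _) (swap_mul_self _ _) (eq_of_toEnd_single fun j => ?_) ?_ ?_⟩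
  · simp only [map_mul, End.mul_apply, toEnd_swap_single]
    obtain rfl | rfl | rfl | hj := hcases j
    · simp [h₀, h₂]
    · simp [h₀, h₂]
    · simp [h₀, h₂]
    · simp [hout j hj]
  · intro h
    have := toEnd_swap_single (K := K) 0 1 0
    rw [h, map_one, End.one_apply, Equiv.swap_apply_left] at this
    exact zero_ne_one (Finsupp.single_left_injective one_ne_zero this)
  · refine Finsupp.basisSingleOne.ext fun j => ?_
    rw [Finsupp.coe_basisSingleOne, braidSum_apply]
    simp only [LinearMap.add_apply, End.mul_apply, End.one_apply, toEnd_swap_single,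
      LinearMap.zero_apply]
    have h2 := add_self_eq_zero_of_charP_two (K := K) (M := ℕ →₀ K)
    have hsum : ((Finsupp.single 0 1 + Finsupp.single 0 1) + (Finsupp.single 1 1 +
        Finsupp.single 1 1) + (Finsupp.single 2 1 + Finsupp.single 2 1) : ℕ →₀ K) = 0 := by
      simp only [h2]
    obtain rfl | rfl | rfl | hj := hcases j
    · simp only [h₀, h₂, Equiv.swap_apply_left]
      rw [← hsum]
      abel
    · simp only [h₀, h₂, Equiv.swap_apply_left, Equiv.swap_apply_right]
      rw [← hsum]
      abel
    · simp only [h₂, Equiv.swap_apply_right]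
      rw [← hsum]
      abel
    · simp [hout j hj, h2]

end StableGL

theorem stable_GL_elementary_equivalence_implies_GL2_elementary_equivalence
    (K₁ K₂ : Type) [Field K₁] [Field K₂] [CharP K₁ 2] [CharP K₂ 2]
    (h : @FirstOrder.Language.ElementarilyEquivalent groupLang
      (StableGL K₁) (StableGL K₂) (groupStructure _) (groupStructure _)) :
    @FirstOrder.Language.ElementarilyEquivalent groupLang
      (Matrix.GeneralLinearGroup (Fin 2) K₁) (Matrix.GeneralLinearGroup (Fin 2) K₂)
      (groupStructure _) (groupStructure _) := by
  let _ := groupStructure (StableGL K₁)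
  let _ := groupStructure (StableGL K₂)
  let _ := groupStructure (Matrix.GeneralLinearGroup (Fin 2) K₁)
  let _ := groupStructure (Matrix.GeneralLinearGroup (Fin 2) K₂)
  rw [FirstOrder.Language.elementarilyEquivalent_iff] at h ⊢
  intro f
  rw [← groupLang.realize_iExs_relativize_iff StableGL.exists_isCleanBraidPair
      (fun _ _ => StableGL.isFinitaryRepresentation_toEnd.exists_monoidHom_range_eq) f,
    ← groupLang.realize_iExs_relativize_iff StableGL.exists_isCleanBraidPair
      (fun _ _ => StableGL.isFinitaryRepresentation_toEnd.exists_monoidHom_range_eq) f]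
  exact h _
end

section
/- Let K be a field of characteristic 2 in which 1 is the only cube root of unity, and let A ∈ GL_n(K) satisfy A³ = 1, A ≠ 1, and 2·rank(A − 1) ≤ n. If the set { B·C : B and C are conjugate to A in GL_n(K) and B·C = C·B } meets at most three conjugacy classes of GL_n(K), then A is conjugate in GL_n(K) to the block-diagonal matrix diag(T, I_{n−2}). -/
/-- The block-diagonal `n × n` matrix `diag(T, I_{n-2})`, where `T = !![1,1;1,0]`. -/
def D1mat (K : Type*) [Field K] (n : ℕ) : Matrix (Fin n) (Fin n) K :=
  Matrix.of fun p q =>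
    if (p : ℕ) < 2 ∧ (q : ℕ) < 2 then
      (if (p : ℕ) = 1 ∧ (q : ℕ) = 1 then 0 else 1)
    else (if p = q then 1 else 0)

open Polynomial in
theorem irreducible_X_sq_add_X_add_one {K : Type*} [Field K] [CharP K 2]
    (hcube : ∀ x : K, x ^ 3 = 1 → x = 1) : Irreducible (X ^ 2 + X + 1 : K[X]) := by
  have h2 : (2 : K) = 0 := CharTwo.two_eq_zero
  refine irreducible_of_degree_le_three_of_not_isRoot ?_ fun x hx => ?_
  · rw [show (X ^ 2 + X + 1 : K[X]).natDegree = 2 by compute_degree!]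
    simp
  · have hx : x ^ 2 + x + 1 = 0 := by simpa using hx
    obtain rfl : x = 1 := hcube x (by linear_combination (x - 1) * hx)
    exact one_ne_zero (α := K) (by linear_combination hx - h2)

open Polynomial in
/-- An endomorphism annihilated by a polynomial `p` turns its space into a module over
`AdjoinRoot p`. -/
theorem exists_module_adjoinRoot {K W : Type*} [Field K] [AddCommGroup W] [Module K W]
    (p : K[X]) (g : Module.End K W) (hg : aeval g p = 0) :
    ∃ _ : Module (AdjoinRoot p) W, IsScalarTower K (AdjoinRoot p) W ∧
      ∀ w : W, AdjoinRoot.root p • w = g w := by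
  let φ : AdjoinRoot p →+* Module.End K W :=
    Ideal.Quotient.lift (Ideal.span {p}) (aeval g : K[X] →ₐ[K] Module.End K W).toRingHom
      fun a ha => by
        obtain ⟨b, rfl⟩ := Ideal.mem_span_singleton'.mp ha
        simp [hg]
  have hφ (q : K[X]) : φ (AdjoinRoot.mk p q) = aeval g q := rfl
  let _ : Module (AdjoinRoot p) W := Module.compHom W φ
  have hsmul (a : AdjoinRoot p) (w : W) : a • w = φ a w := rfl
  refine ⟨inferInstance, ⟨fun c a w => ?_⟩, fun w => ?_⟩
  · rw [hsmul, hsmul, Algebra.smul_def, map_mul, AdjoinRoot.algebraMap_eq, ← AdjoinRoot.mk_C, hφ]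
    simp
  · rw [hsmul, ← AdjoinRoot.mk_X, hφ, aeval_X]

open Polynomial in
theorem natDegree_dvd_finrank_of_aeval_eq_zero {K W : Type*} [Field K] [AddCommGroup W]
    [Module K W] {p : K[X]} (hp : Irreducible p) (g : Module.End K W) (hg : aeval g p = 0) :
    p.natDegree ∣ Module.finrank K W := by
  have : Fact (Irreducible p) := ⟨hp⟩
  obtain ⟨_, _, -⟩ := exists_module_adjoinRoot p g hg
  refine ⟨Module.finrank (AdjoinRoot p) W, ?_⟩
  rw [← Module.finrank_mul_finrank K (AdjoinRoot p) W,
    (AdjoinRoot.powerBasis hp.ne_zero).finrank, AdjoinRoot.powerBasis_dim]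

open Polynomial in
theorem exists_intertwining_equiv_of_aeval_eq_zero {K W W' : Type*} [Field K]
    [AddCommGroup W] [Module K W] [FiniteDimensional K W]
    [AddCommGroup W'] [Module K W'] [FiniteDimensional K W']
    {p : K[X]} (hp : Irreducible p) (g : Module.End K W) (g' : Module.End K W')
    (hg : aeval g p = 0) (hg' : aeval g' p = 0)
    (hfin : Module.finrank K W = Module.finrank K W') :
    ∃ e : W ≃ₗ[K] W', ∀ w, e (g w) = g' (e w) := by
  have : Fact (Irreducible p) := ⟨hp⟩
  obtain ⟨_, _, hroot⟩ := exists_module_adjoinRoot p g hg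
  obtain ⟨_, _, hroot'⟩ := exists_module_adjoinRoot p g' hg'
  have := Module.Finite.of_restrictScalars_finite K (AdjoinRoot p) W
  have := Module.Finite.of_restrictScalars_finite K (AdjoinRoot p) W'
  have : Module.Finite K (AdjoinRoot p) := (AdjoinRoot.powerBasis hp.ne_zero).finite
  have hL : Module.finrank (AdjoinRoot p) W = Module.finrank (AdjoinRoot p) W' := by
    rw [← Module.finrank_mul_finrank K (AdjoinRoot p) W,
      ← Module.finrank_mul_finrank K (AdjoinRoot p) W'] at hfin
    exact Nat.eq_of_mul_eq_mul_left Module.finrank_pos hfin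
  let e := LinearEquiv.ofFinrankEq (R := AdjoinRoot p) W W' hL
  exact ⟨e.restrictScalars K, fun w => by
    rw [← hroot, ← hroot', LinearEquiv.restrictScalars_apply, LinearEquiv.restrictScalars_apply,
      map_smul]⟩

open Polynomial in
theorem isCoprime_X_sub_one_X_sq_add_X_add_one {K : Type*} [Field K] [CharP K 2] :
    IsCoprime (X - 1 : K[X]) (X ^ 2 + X + 1) :=
  ⟨-(X + 2), 1, by linear_combination (CharTwo.two_eq_zero : (2 : K[X]) = 0)⟩

open Polynomial in
theorem isCompl_ker_of_pow_three_eq_one {K V : Type*} [Field K] [CharP K 2]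
    [AddCommGroup V] [Module K V] (f : Module.End K V) (hf : f ^ 3 = 1) :
    IsCompl (LinearMap.ker (aeval f (X - 1 : K[X])))
      (LinearMap.ker (aeval f (X ^ 2 + X + 1 : K[X]))) := by
  refine ⟨disjoint_ker_aeval_of_isCoprime f isCoprime_X_sub_one_X_sq_add_X_add_one, ?_⟩
  rw [codisjoint_iff,
    sup_ker_aeval_eq_ker_aeval_mul_of_coprime f isCoprime_X_sub_one_X_sq_add_X_add_one,
    show (X - 1 : K[X]) * (X ^ 2 + X + 1) = X ^ 3 - 1 by ring,
    show aeval f (X ^ 3 - 1 : K[X]) = 0 by simp [hf], LinearMap.ker_zero]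

open Polynomial in
theorem finrank_ker_of_pow_three_eq_one {K V : Type*} [Field K] [CharP K 2]
    [AddCommGroup V] [Module K V] [FiniteDimensional K V] (f : Module.End K V) (hf : f ^ 3 = 1) :
    Module.finrank K (LinearMap.ker (aeval f (X ^ 2 + X + 1 : K[X]))) =
      Module.finrank K (LinearMap.range (f - 1)) := by
  have h₁ := Submodule.finrank_add_eq_of_isCompl (isCompl_ker_of_pow_three_eq_one f hf)
  have h₂ := LinearMap.finrank_range_add_finrank_ker (f - 1)
  rw [show aeval f (X - 1 : K[X]) = f - 1 by simp] at h₁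
  omega

open Polynomial in
theorem aeval_restrict_ker_eq_zero {K V : Type*} [Field K] [AddCommGroup V] [Module K V]
    (f : Module.End K V) (p : K[X])
    (h : ∀ v ∈ LinearMap.ker (aeval f p), f v ∈ LinearMap.ker (aeval f p)) :
    aeval (f.restrict h) p = 0 := by
  have key (q : K[X]) : ∀ v, (aeval (f.restrict h) q v : V) = aeval f q v := by
    induction q using Polynomial.induction_on' with
    | add a b ha hb => simp [ha, hb]
    | monomial n c =>
      intro v
      simp [aeval_monomial, Module.End.pow_restrict n h]
  ext v
  rw [key]
  exact v.2

theorem mapsTo_ker_aeval {K V : Type*} [Field K] [AddCommGroup V] [Module K V]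
    (f : Module.End K V) (p : Polynomial K) (v : V)
    (hv : v ∈ LinearMap.ker (Polynomial.aeval f p)) :
    f v ∈ LinearMap.ker (Polynomial.aeval f p) := by
  have h : Polynomial.aeval f p * f = f * Polynomial.aeval f p := by
    simpa using congrArg (Polynomial.aeval f) (mul_comm p Polynomial.X)
  rw [LinearMap.mem_ker] at hv ⊢
  rw [← Module.End.mul_apply, h, Module.End.mul_apply, hv, map_zero]

open Polynomial in
theorem exists_intertwining_equiv_of_pow_three_eq_one {K V : Type*} [Field K] [CharP K 2]
    (hcube : ∀ x : K, x ^ 3 = 1 → x = 1)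
    [AddCommGroup V] [Module K V] [FiniteDimensional K V] (f f' : Module.End K V)
    (hf : f ^ 3 = 1) (hf' : f' ^ 3 = 1)
    (hfin : Module.finrank K (LinearMap.range (f - 1)) =
      Module.finrank K (LinearMap.range (f' - 1))) :
    ∃ e : V ≃ₗ[K] V, ∀ v, e (f v) = f' (e v) := by
  have hc := isCompl_ker_of_pow_three_eq_one f hf
  have hc' := isCompl_ker_of_pow_three_eq_one f' hf'
  have hW : Module.finrank K (LinearMap.ker (aeval f (X ^ 2 + X + 1 : K[X]))) =
      Module.finrank K (LinearMap.ker (aeval f' (X ^ 2 + X + 1 : K[X]))) := by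
    rw [finrank_ker_of_pow_three_eq_one f hf, finrank_ker_of_pow_three_eq_one f' hf', hfin]
  have hZ : Module.finrank K (LinearMap.ker (aeval f (X - 1 : K[X]))) =
      Module.finrank K (LinearMap.ker (aeval f' (X - 1 : K[X]))) := by
    have h₁ := Submodule.finrank_add_eq_of_isCompl hc
    have h₂ := Submodule.finrank_add_eq_of_isCompl hc'
    omega
  obtain ⟨e₂, he₂⟩ := exists_intertwining_equiv_of_aeval_eq_zero
    (irreducible_X_sq_add_X_add_one hcube) _ _
    (aeval_restrict_ker_eq_zero f _ (mapsTo_ker_aeval f _))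
    (aeval_restrict_ker_eq_zero f' _ (mapsTo_ker_aeval f' _)) hW
  let e₁ := LinearEquiv.ofFinrankEq (R := K) _ _ hZ
  let d := Submodule.prodEquivOfIsCompl _ _ hc
  let d' := Submodule.prodEquivOfIsCompl _ _ hc'
  have hfix (g : Module.End K V) (z : LinearMap.ker (aeval g (X - 1 : K[X]))) :
      g z = z := by
    have := z.2
    simpa [sub_eq_zero] using this
  refine ⟨d.symm.trans ((e₁.prodCongr e₂).trans d'), fun v => ?_⟩
  obtain ⟨⟨z, w⟩, rfl⟩ := d.surjective v
  have hd : f (d (z, w)) = d (z, f.restrict (mapsTo_ker_aeval f (X ^ 2 + X + 1)) w) := by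
    simp [d, hfix]
  have hd' : f' (d' (e₁ z, e₂ w)) =
      d' (e₁ z, f'.restrict (mapsTo_ker_aeval f' (X ^ 2 + X + 1)) (e₂ w)) := by
    simp [d', hfix]
  rw [hd]
  simp only [LinearEquiv.trans_apply, LinearEquiv.symm_apply_apply, LinearEquiv.prodCongr_apply]
  rw [hd', he₂]

theorem isConj_of_pow_three_eq_one {K : Type*} [Field K] [CharP K 2]
    (hcube : ∀ x : K, x ^ 3 = 1 → x = 1) {n : ℕ}
    (A B : Matrix.GeneralLinearGroup (Fin n) K) (hA : A ^ 3 = 1) (hB : B ^ 3 = 1)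
    (hrank : ((A : Matrix (Fin n) (Fin n) K) - 1).rank =
      ((B : Matrix (Fin n) (Fin n) K) - 1).rank) : IsConj A B := by
  let φ := (Matrix.toLinAlgEquiv' : Matrix (Fin n) (Fin n) K ≃ₐ[K] _)
  have hpow (C : Matrix.GeneralLinearGroup (Fin n) K) (hC : C ^ 3 = 1) :
      φ (C : Matrix (Fin n) (Fin n) K) ^ 3 = 1 := by
    rw [← map_pow, ← Units.val_pow_eq_pow_val, hC, Units.val_one, map_one]
  have hr (C : Matrix (Fin n) (Fin n) K) :
      Module.finrank K (LinearMap.range (φ C - 1)) = (C - 1).rank := by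
    rw [← map_one φ, ← map_sub]; rfl
  obtain ⟨e, he⟩ := exists_intertwining_equiv_of_pow_three_eq_one hcube (φ A) (φ B)
    (hpow A hA) (hpow B hB) (by rw [hr, hr, hrank])
  let U : Matrix.GeneralLinearGroup (Fin n) K :=
    Units.map φ.symm.toMonoidHom (LinearMap.GeneralLinearGroup.ofLinearEquiv e)
  have hU : φ (U : Matrix (Fin n) (Fin n) K) = (e : (Fin n → K) →ₗ[K] (Fin n → K)) :=
    φ.apply_symm_apply _
  rw [isConj_iff]
  refine ⟨U, ?_⟩
  rw [mul_inv_eq_iff_eq_mul]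
  refine Units.ext (φ.injective ?_)
  rw [Units.val_mul, Units.val_mul, map_mul, map_mul, hU]
  exact LinearMap.ext he

open Polynomial in
theorem even_rank_sub_one_of_pow_three_eq_one {K : Type*} [Field K] [CharP K 2]
    (hcube : ∀ x : K, x ^ 3 = 1 → x = 1) {n : ℕ}
    (A : Matrix (Fin n) (Fin n) K) (hA : A ^ 3 = 1) : 2 ∣ (A - 1).rank := by
  let f : Module.End K (Fin n → K) := Matrix.toLinAlgEquiv' A
  have hf : f ^ 3 = 1 := by rw [← map_pow, hA, map_one]
  have hr : Module.finrank K (LinearMap.range (f - 1)) = (A - 1).rank := by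
    rw [← map_one Matrix.toLinAlgEquiv', ← map_sub]; rfl
  have h := natDegree_dvd_finrank_of_aeval_eq_zero (irreducible_X_sq_add_X_add_one hcube) _
    (aeval_restrict_ker_eq_zero f _ (mapsTo_ker_aeval f _))
  rwa [finrank_ker_of_pow_three_eq_one f hf, hr,
    show (X ^ 2 + X + 1 : K[X]).natDegree = 2 by compute_degree!] at h

theorem rank_sub_one_eq_of_isConj {K : Type*} [Field K] {n : ℕ}
    {A B : Matrix.GeneralLinearGroup (Fin n) K} (h : IsConj A B) :
    ((A : Matrix (Fin n) (Fin n) K) - 1).rank = ((B : Matrix (Fin n) (Fin n) K) - 1).rank := by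
  obtain ⟨U, rfl⟩ := isConj_iff.mp h
  have hU (V : Matrix.GeneralLinearGroup (Fin n) K) :
      IsUnit (V : Matrix (Fin n) (Fin n) K).det := (Matrix.isUnit_iff_isUnit_det _).mp V.isUnit
  have : ((U * A * U⁻¹ : Matrix.GeneralLinearGroup (Fin n) K) : Matrix (Fin n) (Fin n) K) - 1 =
      U * ((A : Matrix (Fin n) (Fin n) K) - 1) *
        (U⁻¹ : Matrix.GeneralLinearGroup (Fin n) K) := by
    rw [mul_sub, sub_mul, mul_one, Units.mul_inv]
    rfl
  rw [this, Matrix.rank_mul_eq_left_of_isUnit_det _ _ (hU _),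
    Matrix.rank_mul_eq_right_of_isUnit_det _ _ (hU _)]

/-- The block-diagonal matrix with diagonal blocks `T ^ a i`, followed by an identity block. -/
def blockPow (K : Type*) [Field K] {o m : Type*} [DecidableEq o] [DecidableEq m] (a : o → ℕ) :
    Matrix ((Fin 2 × o) ⊕ m) ((Fin 2 × o) ⊕ m) K :=
  Matrix.fromBlocks (Matrix.blockDiagonal fun i => !![1, 1; 1, 0] ^ a i) 0 0 1

theorem pow_three_eq_one_of_charTwo {K : Type*} [Field K] [CharP K 2] :
    (!![1, 1; 1, 0] : Matrix (Fin 2) (Fin 2) K) ^ 3 = 1 := by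
  have h2 : (1 : K) + 1 = 0 := CharTwo.add_self_eq_zero 1
  simp [pow_succ, Matrix.one_fin_two, h2]

theorem isUnit_det_pow_sub_one {K : Type*} [Field K] [CharP K 2] (k : ℕ) (hk : ¬ 3 ∣ k) :
    IsUnit ((!![1, 1; 1, 0] : Matrix (Fin 2) (Fin 2) K) ^ k - 1).det := by
  have h2 : (1 : K) + 1 = 0 := CharTwo.add_self_eq_zero 1
  rw [pow_eq_pow_mod k pow_three_eq_one_of_charTwo]
  have : k % 3 = 1 ∨ k % 3 = 2 := by omega
  rcases this with h | h <;> rw [h] <;>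
    simp [pow_succ, Matrix.one_fin_two, h2, Matrix.det_fin_two]

theorem blockPow_zero {K : Type*} [Field K] {o m : Type*} [DecidableEq o]
    [DecidableEq m] : blockPow K (m := m) (0 : o → ℕ) = 1 := by
  simp only [blockPow, Pi.zero_apply, pow_zero]
  rw [← Matrix.fromBlocks_one, ← Matrix.blockDiagonal_one]
  rfl

theorem blockPow_eq_one {K : Type*} [Field K] [CharP K 2] {o m : Type*} [DecidableEq o]
    [DecidableEq m] (a : o → ℕ) (ha : ∀ i, 3 ∣ a i) :
    blockPow K (m := m) a = 1 := by
  rw [← blockPow_zero (K := K) (o := o)]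
  unfold blockPow
  congr 2
  ext1 i
  rw [pow_eq_pow_mod _ pow_three_eq_one_of_charTwo, Nat.mod_eq_zero_of_dvd (ha i)]
  rfl

section blockPow

variable {K : Type*} [Field K] {o m : Type*} [Fintype o] [DecidableEq o] [Fintype m]
  [DecidableEq m]

theorem blockPow_mul (a b : o → ℕ) :
    blockPow K (m := m) a * blockPow K b = blockPow K (a + b) := by
  simp [blockPow, Matrix.fromBlocks_multiply, ← Matrix.blockDiagonal_mul, pow_add]

theorem rank_blockPow_sub_one [CharP K 2] (a : o → ℕ) :
    (blockPow K (m := m) a - 1).rank = ∑ i, if 3 ∣ a i then 0 else 2 := by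
  classical
  let w : (Fin 2 × o) ⊕ m → K := Sum.elim (fun x => if 3 ∣ a x.2 then 0 else 1) 0
  let b : o → Matrix (Fin 2) (Fin 2) K := fun i =>
    if 3 ∣ a i then 1 else !![1, 1; 1, 0] ^ a i - 1
  let B : Matrix ((Fin 2 × o) ⊕ m) ((Fin 2 × o) ⊕ m) K :=
    Matrix.fromBlocks (Matrix.blockDiagonal b) 0 0 1
  have hB : IsUnit B.det := by
    rw [Matrix.det_fromBlocks_zero₂₁, Matrix.det_blockDiagonal, Matrix.det_one, mul_one]
    refine IsUnit.prod_univ_iff.mpr fun i => ?_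
    by_cases h : 3 ∣ a i
    · simp [b, h]
    · simpa only [b, h, if_false] using isUnit_det_pow_sub_one (a i) h
  have hfac : blockPow K (m := m) a - 1 = B * Matrix.diagonal w := by
    have h₁ : (fun i => (!![1, 1; 1, 0] : Matrix (Fin 2) (Fin 2) K) ^ a i) - 1 =
        fun i => b i * Matrix.diagonal fun _ => if 3 ∣ a i then 0 else 1 := by
      ext1 i
      by_cases h : 3 ∣ a i
      · have : (!![1, 1; 1, 0] : Matrix (Fin 2) (Fin 2) K) ^ a i = 1 := by
          rw [pow_eq_pow_mod _ pow_three_eq_one_of_charTwo, Nat.mod_eq_zero_of_dvd h, pow_zero]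
        simp [b, h, this]
      · simp [b, h]
    have h₂ : Matrix.diagonal w = Matrix.fromBlocks
        (Matrix.blockDiagonal fun i => Matrix.diagonal fun _ => if 3 ∣ a i then 0 else 1)
        0 0 0 := by
      rw [Matrix.blockDiagonal_diagonal, ← Matrix.diagonal_zero, Matrix.fromBlocks_diagonal]
      rfl
    rw [h₂, Matrix.fromBlocks_multiply, ← Matrix.blockDiagonal_mul, ← h₁,
      Matrix.blockDiagonal_sub, Matrix.blockDiagonal_one, sub_eq_iff_eq_add,
      ← Matrix.fromBlocks_one, Matrix.fromBlocks_add]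
    simp [blockPow]
  rw [hfac, Matrix.rank_mul_eq_right_of_isUnit_det _ _ hB, Matrix.rank_diagonal,
    Fintype.card_subtype, Finset.card_filter, Fintype.sum_sum_type, Fintype.sum_prod_type]
  simp [w, Finset.mul_sum]

/-- The matrix `blockPow K a`, with its index type identified with `Fin n`, as a unit. -/
noncomputable def blockPowGL [CharP K 2] {n : ℕ} (e : (Fin 2 × o) ⊕ m ≃ Fin n) (a : o → ℕ) :
    Matrix.GeneralLinearGroup (Fin n) K :=
  Units.map (Matrix.reindexAlgEquiv K K e).toMonoidHom
    ⟨blockPow K a, blockPow K (2 * a),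
      by rw [blockPow_mul, blockPow_eq_one]; intro i; simp; omega,
      by rw [blockPow_mul, blockPow_eq_one]; intro i; simp; omega⟩

variable [CharP K 2] {n : ℕ} (e : (Fin 2 × o) ⊕ m ≃ Fin n)

theorem coe_blockPowGL (a : o → ℕ) :
    (blockPowGL (K := K) e a : Matrix (Fin n) (Fin n) K) =
      Matrix.reindexAlgEquiv K K e (blockPow K a) := rfl

theorem blockPowGL_mul (a b : o → ℕ) :
    blockPowGL (K := K) e a * blockPowGL e b = blockPowGL e (a + b) := by
  ext1
  rw [Units.val_mul, coe_blockPowGL, coe_blockPowGL, coe_blockPowGL, ← map_mul, blockPow_mul]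

theorem blockPowGL_pow_three (a : o → ℕ) : blockPowGL (K := K) e a ^ 3 = 1 := by
  rw [pow_succ, pow_two, blockPowGL_mul, blockPowGL_mul]
  refine Units.ext ?_
  rw [coe_blockPowGL, blockPow_eq_one, map_one, Units.val_one]
  intro i
  simp only [Pi.add_apply]
  omega

theorem rank_blockPowGL_sub_one (a : o → ℕ) :
    ((blockPowGL (K := K) e a : Matrix (Fin n) (Fin n) K) - 1).rank =
      ∑ i, if 3 ∣ a i then 0 else 2 := by
  rw [coe_blockPowGL, ← map_one (Matrix.reindexAlgEquiv K K e), ← map_sub,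
    Matrix.coe_reindexAlgEquiv, Matrix.rank_reindex, rank_blockPow_sub_one]

end blockPow

theorem exists_blockPowGL_eq_D1mat {K : Type*} [Field K] [CharP K 2] (m : ℕ) :
    ∃ e : (Fin 2 × Unit) ⊕ Fin m ≃ Fin (2 + m),
      (blockPowGL (K := K) e 1 : Matrix (Fin (2 + m)) (Fin (2 + m)) K) = D1mat K (2 + m) := by
  let e := ((Equiv.prodPUnit (Fin 2)).sumCongr (Equiv.refl (Fin m))).trans finSumFinEquiv
  refine ⟨e, ?_⟩
  ext i j
  obtain ⟨i, rfl⟩ := e.surjective i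
  obtain ⟨j, rfl⟩ := e.surjective j
  rw [coe_blockPowGL, Matrix.coe_reindexAlgEquiv, Matrix.reindex_apply, Matrix.submatrix_apply,
    Equiv.symm_apply_apply, Equiv.symm_apply_apply]
  rcases i with ⟨i, -⟩ | i <;> rcases j with ⟨j, -⟩ | j
  · fin_cases i <;> fin_cases j <;> simp [blockPow, D1mat, e, Matrix.blockDiagonal_apply]
  · fin_cases i <;> simp [blockPow, D1mat, e, Fin.ext_iff] <;> grind
  · fin_cases j <;> simp [blockPow, D1mat, e, Fin.ext_iff] <;> grind
  · simp [blockPow, D1mat, e, Matrix.one_apply, Fin.ext_iff]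
    intros
    omega

theorem few_classes_implies_conjugate_to_diag_T_id
    (K : Type*) [Field K] [CharP K 2]
    (hcube : ∀ x : K, x ^ 3 = 1 → x = 1)
    (n : ℕ) (A : Matrix.GeneralLinearGroup (Fin n) K)
    (hA3 : A ^ 3 = 1) (hA1 : A ≠ 1)
    (hrank : 2 * ((A : Matrix (Fin n) (Fin n) K) - 1).rank ≤ n)
    (hclasses : ∃ X Y Z : Matrix.GeneralLinearGroup (Fin n) K,
      ∀ B C : Matrix.GeneralLinearGroup (Fin n) K,
        IsConj A B → IsConj A C → B * C = C * B →
          IsConj (B * C) X ∨ IsConj (B * C) Y ∨ IsConj (B * C) Z) :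
    ∃ U : Matrix.GeneralLinearGroup (Fin n) K,
      ((U * A * U⁻¹ : Matrix.GeneralLinearGroup (Fin n) K) :
        Matrix (Fin n) (Fin n) K) = D1mat K n := by
  obtain ⟨k, hk⟩ := even_rank_sub_one_of_pow_three_eq_one hcube (A : Matrix (Fin n) (Fin n) K)
    (by rw [← Units.val_pow_eq_pow_val, hA3, Units.val_one])
  have hk0 : k ≠ 0 := by
    rintro rfl
    refine hA1 (isConj_one_right.mp (isConj_of_pow_three_eq_one hcube 1 A (one_pow 3) hA3 ?_))
    rw [hk, Units.val_one, sub_self, Matrix.rank_zero]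
  have conj {o m : Type} [Fintype o] [DecidableEq o] [Fintype m] [DecidableEq m]
      (e : (Fin 2 × o) ⊕ m ≃ Fin n) (a : o → ℕ) (ha : ∑ i, (if 3 ∣ a i then 0 else 2) = 2 * k) :
      IsConj A (blockPowGL e a) :=
    isConj_of_pow_three_eq_one hcube _ _ hA3 (blockPowGL_pow_three e a)
      (by rw [hk, rank_blockPowGL_sub_one, ha])
  obtain rfl | ⟨j, rfl⟩ : k = 1 ∨ ∃ j, k = j + 2 := by
    rcases k with _ | _ | j
    · exact absurd rfl hk0
    · exact Or.inl rfl
    · exact Or.inr ⟨j, rfl⟩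
  · obtain ⟨m, rfl⟩ : ∃ m, n = 2 + m := ⟨n - 2, by omega⟩
    obtain ⟨e, he⟩ := exists_blockPowGL_eq_D1mat (K := K) m
    obtain ⟨U, hU⟩ := isConj_iff.mp (conj e 1 (by simp))
    exact ⟨U, by rw [hU, he]⟩
  · exfalso
    obtain ⟨X, Y, Z, h⟩ := hclasses
    let o := Fin (j + 2) ⊕ Fin (j + 2)
    let e : (Fin 2 × o) ⊕ Fin (n - 4 * (j + 2)) ≃ Fin n := Fintype.equivFinOfCardEq (by
      simp only [o, Fintype.card_sum, Fintype.card_prod, Fintype.card_fin]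
      omega)
    have key (a b : o → ℕ) (ha : ∑ i, (if 3 ∣ a i then 0 else 2) = 2 * (j + 2))
        (hb : ∑ i, (if 3 ∣ b i then 0 else 2) = 2 * (j + 2)) (r : ℕ)
        (hr : ∑ i, (if 3 ∣ (a + b) i then 0 else 2) = r) :
        r = ((X : Matrix (Fin n) (Fin n) K) - 1).rank ∨
          r = ((Y : Matrix (Fin n) (Fin n) K) - 1).rank ∨
          r = ((Z : Matrix (Fin n) (Fin n) K) - 1).rank := by
      have := h _ _ (conj e a ha) (conj e b hb)
        (by rw [blockPowGL_mul, blockPowGL_mul, add_comm a b])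
      rw [← hr, ← rank_blockPowGL_sub_one (K := K) e, ← blockPowGL_mul]
      exact this.imp rank_sub_one_eq_of_isConj
        (Or.imp rank_sub_one_eq_of_isConj rank_sub_one_eq_of_isConj)
    let a : o → ℕ := Sum.elim 1 0
    have ha : ∑ i, (if 3 ∣ a i then 0 else 2) = 2 * (j + 2) := by
      simp [a, o, mul_comm]
    have h₀ := key a (Sum.elim 2 0) ha (by simp [o, mul_comm]) 0 (by simp [a, o])
    have h₁ := key a (Sum.elim (Fin.cons 1 2) 0) ha
      (by simp [o, Fin.sum_univ_succ]; ring) 2 (by simp [a, o, Fin.sum_univ_succ])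
    have h₂ := key a a ha ha (2 * (j + 2)) (by simp [a, o, mul_comm])
    have h₃ := key a (Sum.elim 0 1) ha (by simp [o, mul_comm]) (4 * (j + 2))
      (by simp [a, o]; ring)
    omega
end
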